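/- (Banach–Zaretsky theorem.) Let γ : I → X. Then γ is locally absolutely continuous if and only if γ is continuous, locally of bounded variation, and has Luzin's property (N). -/

import Mathlib

open Filter Topology Set MeasureTheory

/-- `γ` is (metrically) absolutely continuous on the set `S`. -/
def MetricAC {X : Type*} [MetricSpace X] (γ : ℝ → X) (S : Set ℝ) : Prop :=
  ∀ ε : ℝ, 0 < ε → ∃ δ : ℝ, 0 < δ ∧
    ∀ (n : ℕ) (a b : ℕ → ℝ),
      (∀ k < n, a k ∈ S ∧ b k ∈ S ∧ a k ≤ b k) →
      (∀ j < n, ∀ k < n, j ≠ k → Disjoint (Set.Ioo (a j) (b j)) (Set.Ioo (a k) (b k))) →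
      (∑ k ∈ Finset.range n, (b k - a k)) ≤ δ →
      (∑ k ∈ Finset.range n, dist (γ (a k)) (γ (b k))) ≤ ε

/-- `γ` is locally absolutely continuous on the interval `I`. -/
def MetricACloc {X : Type*} [MetricSpace X] (γ : ℝ → X) (I : Set ℝ) : Prop :=
  ∀ a ∈ I, ∀ b ∈ I, a ≤ b → MetricAC γ (Set.Icc a b)

/-- `γ` has Luzin's property (N) on `I`. -/
def LuzinN {X : Type*} [MetricSpace X] [MeasurableSpace X] [BorelSpace X]
    (γ : ℝ → X) (I : Set ℝ) : Prop :=
  ∀ N : Set ℝ, N ⊆ I → volume N = 0 → μH[1] (γ '' N) = 0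

namespace BoundedVariationOn

variable {X : Type*} [MetricSpace X] {g : ℝ → X}

/-- The variation of a continuous function of bounded variation, as a Stieltjes function. -/
noncomputable def variationStieltjes (hg : BoundedVariationOn g univ) (hc : Continuous g) :
    StieltjesFunction ℝ where
  toFun := variationOnFromTo g univ 0
  mono' := by
    rw [← monotoneOn_univ]
    exact variationOnFromTo.monotoneOn hg.locallyBoundedVariationOn (mem_univ _)
  right_continuous' _ :=
    hg.continuousWithinAt_variationOnFromTo_Ici hc.continuousAt.continuousWithinAt

instance (hg : BoundedVariationOn g univ) (hc : Continuous g) :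
    IsFiniteMeasure (hg.variationStieltjes hc).measure :=
  StieltjesFunction.isFiniteMeasure_of_forall_abs_le _
    fun _ ↦ variationOnFromTo.abs_le_eVariationOn hg

lemma ofReal_variationStieltjes_sub (hg : BoundedVariationOn g univ) (hc : Continuous g)
    {s t : ℝ} (hst : s ≤ t) :
    ENNReal.ofReal (hg.variationStieltjes hc t - hg.variationStieltjes hc s) =
      eVariationOn g (Icc s t) := by
  change ENNReal.ofReal (variationOnFromTo g univ 0 t - variationOnFromTo g univ 0 s) = _
  rw [variationOnFromTo.sub_right hg.locallyBoundedVariationOn (mem_univ _) (mem_univ _)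
    (mem_univ _), variationOnFromTo.eq_of_le _ _ hst, univ_inter,
    ENNReal.ofReal_toReal (hg.mono (subset_univ _))]

lemma edist_le_edist_variationStieltjes (hg : BoundedVariationOn g univ) (hc : Continuous g)
    (s t : ℝ) :
    edist (g s) (g t) ≤ edist (hg.variationStieltjes hc s) (hg.variationStieltjes hc t) := by
  wlog hst : s ≤ t generalizing s t
  · rw [edist_comm, edist_comm (hg.variationStieltjes hc s)]
    exact this _ _ (le_of_not_ge hst)
  rw [edist_comm (hg.variationStieltjes hc s), edist_dist (hg.variationStieltjes hc t),
    Real.dist_eq, abs_of_nonneg (sub_nonneg.2 ((hg.variationStieltjes hc).mono hst)),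
    hg.ofReal_variationStieltjes_sub hc hst]
  exact eVariationOn.edist_le _ (left_mem_Icc.2 hst) (right_mem_Icc.2 hst)

end BoundedVariationOn

section Hausdorff

variable {X : Type*} [MetricSpace X] [MeasurableSpace X] [BorelSpace X]

lemma hausdorffMeasure_image_le_of_edist_le {α Y : Type*} [MetricSpace Y] [MeasurableSpace Y]
    [BorelSpace Y] {g : α → X} {v : α → Y} (h : ∀ s t, edist (g s) (g t) ≤ edist (v s) (v t))
    {d : ℝ} (hd : 0 ≤ d) (E : Set α) : μH[d] (g '' E) ≤ μH[d] (v '' E) := by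
  rcases isEmpty_or_nonempty α with hα | hα
  · simp [Set.eq_empty_of_isEmpty E]
  have hinv : ∀ y ∈ range v, v (Function.invFun v y) = y := fun y hy ↦ Function.invFun_eq hy
  have hlip : LipschitzOnWith 1 (g ∘ Function.invFun v) (v '' E) := by
    intro y hy z hz
    calc edist (g (Function.invFun v y)) (g (Function.invFun v z))
        ≤ edist (v (Function.invFun v y)) (v (Function.invFun v z)) := h _ _
      _ = (1 : NNReal) * edist y z := by
        rw [hinv y (image_subset_range _ _ hy), hinv z (image_subset_range _ _ hz)]; simp
  have himg : (g ∘ Function.invFun v) '' (v '' E) = g '' E := by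
    rw [image_image]
    refine image_congr fun x _ ↦ ?_
    have := h (Function.invFun v (v x)) x
    rw [hinv _ (mem_range_self x), edist_self] at this
    exact edist_eq_zero.1 (le_antisymm this bot_le)
  rw [← himg]
  simpa using hlip.hausdorffMeasure_image_le hd

lemma edist_le_hausdorffMeasure_image_Icc {g : ℝ → X} {s t : ℝ} (hst : s ≤ t)
    (hg : ContinuousOn g (Icc s t)) : edist (g s) (g t) ≤ μH[1] (g '' Icc s t) := by
  have hlip : LipschitzWith 1 (fun y ↦ dist (g s) y) := LipschitzWith.dist_right _
  have hsub : Icc 0 (dist (g s) (g t)) ⊆ (fun y ↦ dist (g s) y) '' (g '' Icc s t) := by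
    rw [image_image]
    simpa using intermediate_value_Icc (f := fun x ↦ dist (g s) (g x)) hst
      (hlip.continuous.comp_continuousOn hg)
  calc edist (g s) (g t) = μH[1] (Icc 0 (dist (g s) (g t))) := by
        rw [hausdorffMeasure_real, Real.volume_Icc, sub_zero, edist_dist]
    _ ≤ μH[1] ((fun y ↦ dist (g s) y) '' (g '' Icc s t)) := measure_mono hsub
    _ ≤ μH[1] (g '' Icc s t) := by
      simpa using hlip.hausdorffMeasure_image_le zero_le_one (g '' Icc s t)

end Hausdorff

namespace BoundedVariationOn

variable {X : Type*} [MetricSpace X] [MeasurableSpace X] [BorelSpace X] {g : ℝ → X}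

lemma hausdorffMeasure_image_le (hg : BoundedVariationOn g univ) (hc : Continuous g)
    (E : Set ℝ) : μH[1] (g '' E) ≤ (hg.variationStieltjes hc).measure E := by
  set F := hg.variationStieltjes hc with hF
  have key : OuterMeasure.comap g (μH[1] : Measure X).toOuterMeasure ≤ F.outer := by
    refine OuterMeasure.le_ofFunction.2 fun s ↦ ?_
    rw [OuterMeasure.comap_apply, F.length_eq]
    refine le_iInf fun a ↦ le_iInf fun b ↦ le_iInf fun hs ↦ ?_
    replace hs : s ⊆ Ioc a b := fun x hx ↦ hs ⟨hx, not_isBot x⟩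
    calc μH[1] (g '' s) ≤ μH[1] (F '' s) :=
          hausdorffMeasure_image_le_of_edist_le (hg.edist_le_edist_variationStieltjes hc)
            zero_le_one s
      _ ≤ μH[1] (Icc (F a) (F b)) := by
          refine measure_mono ?_
          rintro _ ⟨x, hx, rfl⟩
          exact ⟨F.mono (hs hx).1.le, F.mono (hs hx).2⟩
      _ = ENNReal.ofReal (F b - F a) := by rw [hausdorffMeasure_real, Real.volume_Icc]
  rw [StieltjesFunction.measure]
  exact key E

lemma eVariationOn_Icc_le_measure_diff (hg : BoundedVariationOn g univ) (hc : Continuous g)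
    {N : Set ℝ} (hN : MeasurableSet N)
    (h0 : μH[1] (g '' N) = 0) (a b : ℝ) :
    eVariationOn g (Icc a b) ≤ (hg.variationStieltjes hc).measure (Ioc a b \ N) := by
  have piece : ∀ s t, s ≤ t →
      edist (g s) (g t) ≤ (hg.variationStieltjes hc).measure (Ioc s t \ N) := by
    intro s t hst
    have hsub : g '' Icc s t ⊆ g '' (Ioc s t \ N) ∪ (g '' N ∪ {g s}) := by
      rintro _ ⟨x, hx, rfl⟩
      by_cases hxN : x ∈ N
      · exact Or.inr (Or.inl (mem_image_of_mem g hxN))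
      · rcases hx.1.eq_or_lt with rfl | hlt
        · exact Or.inr (Or.inr rfl)
        · exact Or.inl (mem_image_of_mem g ⟨⟨hlt, hx.2⟩, hxN⟩)
    have hpt : μH[1] ({g s} : Set X) = 0 := by
      have := Measure.nullSingletonClass_hausdorff X (d := 1) one_pos
      exact measure_singleton _
    calc edist (g s) (g t) ≤ μH[1] (g '' Icc s t) :=
          edist_le_hausdorffMeasure_image_Icc hst hc.continuousOn
      _ ≤ μH[1] (g '' (Ioc s t \ N)) + (μH[1] (g '' N) + μH[1] ({g s} : Set X)) :=
          (measure_mono hsub).trans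
            ((measure_union_le _ _).trans (by gcongr; exact measure_union_le _ _))
      _ = μH[1] (g '' (Ioc s t \ N)) := by rw [h0, hpt]; simp
      _ ≤ _ := hg.hausdorffMeasure_image_le hc _
  refine iSup_le ?_
  rintro ⟨n, u, hu, hab⟩
  calc ∑ i ∈ Finset.range n, edist (g (u (i + 1))) (g (u i))
      ≤ ∑ i ∈ Finset.range n,
          (hg.variationStieltjes hc).measure (Ioc (u i) (u (i + 1)) \ N) := by
        refine Finset.sum_le_sum fun i _ ↦ ?_
        rw [edist_comm]
        exact piece _ _ (hu i.le_succ)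
    _ = (hg.variationStieltjes hc).measure
          (⋃ i ∈ Finset.range n, Ioc (u i) (u (i + 1)) \ N) := by
        refine (measure_biUnion_finset ?_ fun i _ ↦ measurableSet_Ioc.diff hN).symm
        intro i _ j _ hij
        exact (hu.pairwise_disjoint_on_Ioc_succ hij).mono sdiff_subset sdiff_subset
    _ ≤ _ := by
        refine measure_mono (iUnion₂_subset fun i _ ↦ ?_)
        exact sdiff_subset_sdiff_left (Ioc_subset_Ioc (hab i).1 (hab (i + 1)).2)

lemma measure_variationStieltjes_absolutelyContinuous (hg : BoundedVariationOn g univ)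
    (hc : Continuous g) (hN : ∀ N : Set ℝ, volume N = 0 → μH[1] (g '' N) = 0) :
    (hg.variationStieltjes hc).measure ≪ volume := by
  refine Measure.AbsolutelyContinuous.mk fun N hm h0 ↦ ?_
  have hIoc : ∀ a b : ℝ, a ≤ b →
      (hg.variationStieltjes hc).measure (Ioc a b ∩ N) = 0 := by
    intro a b hab
    have h1 := hg.eVariationOn_Icc_le_measure_diff hc hm (hN N h0) a b
    rw [← hg.ofReal_variationStieltjes_sub hc hab, ← StieltjesFunction.measure_Ioc,
      ← measure_inter_add_sdiff (Ioc a b) hm] at h1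
    have h2 : (hg.variationStieltjes hc).measure (Ioc a b \ N) ≠ ⊤ := measure_ne_top _ _
    simpa using ENNReal.le_of_add_le_add_right h2 (h1.trans_eq (zero_add _).symm)
  have hcover : N ⊆ ⋃ n : ℕ, Ioc (-(n : ℝ)) n ∩ N := by
    intro x hx
    obtain ⟨n, hn⟩ := exists_nat_gt |x|
    exact mem_iUnion.2 ⟨n, ⟨(abs_lt.1 hn).1, (abs_lt.1 hn).2.le⟩, hx⟩
  refine measure_mono_null hcover (measure_iUnion_null fun n ↦ hIoc _ _ ?_)
  linarith [n.cast_nonneg (α := ℝ)]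

end BoundedVariationOn

lemma MeasureTheory.Measure.AbsolutelyContinuous.exists_pos_forall_measure_lt {α : Type*}
    {m : MeasurableSpace α} {μ ν : Measure α} [IsFiniteMeasure μ] [SigmaFinite ν] (h : μ ≪ ν)
    {ε : ENNReal} (hε : ε ≠ 0) : ∃ δ > 0, ∀ s, ν s < δ → μ s < ε := by
  obtain ⟨δ, hδ, H⟩ := exists_pos_setLIntegral_lt_of_measure_lt
    (Measure.lintegral_rnDeriv_lt_top μ ν).ne hε
  exact ⟨δ, hδ, fun s hs ↦ by simpa [Measure.setLIntegral_rnDeriv h] using H s hs⟩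

lemma disjoint_Ioc_of_disjoint_Ioo {a b c d : ℝ} (h : Disjoint (Ioo a b) (Ioo c d)) :
    Disjoint (Ioc a b) (Ioc c d) := by
  rw [Set.disjoint_left] at h ⊢
  intro x hx hx'
  obtain ⟨y, hy, hyx⟩ := exists_between (max_lt hx.1 hx'.1)
  exact h ⟨(le_max_left _ _).trans_lt hy, hyx.trans_le hx.2⟩
    ⟨(le_max_right _ _).trans_lt hy, hyx.trans_le hx'.2⟩

lemma BoundedVariationOn.metricAC {X : Type*} [MetricSpace X] {g : ℝ → X}
    (hg : BoundedVariationOn g univ) (hc : Continuous g)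
    (hac : (hg.variationStieltjes hc).measure ≪ volume) (S : Set ℝ) : MetricAC g S := by
  intro ε hε
  obtain ⟨δ, hδ, H⟩ := hac.exists_pos_forall_measure_lt (ENNReal.ofReal_pos.2 hε).ne'
  obtain ⟨δ', -, hδ', hδδ⟩ := ENNReal.lt_iff_exists_real_btwn.1 hδ
  have hδ'0 : 0 < δ' := ENNReal.ofReal_pos.1 hδ'
  refine ⟨δ', hδ'0, fun n a b hab hdisj hsum ↦ ?_⟩
  have hvol : volume (⋃ k ∈ Finset.range n, Ioc (a k) (b k)) < δ := by
    calc volume (⋃ k ∈ Finset.range n, Ioc (a k) (b k))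
        ≤ ∑ k ∈ Finset.range n, volume (Ioc (a k) (b k)) := measure_biUnion_finset_le _ _
      _ = ENNReal.ofReal (∑ k ∈ Finset.range n, (b k - a k)) := by
        rw [ENNReal.ofReal_sum_of_nonneg fun k hk ↦
          sub_nonneg.2 (hab k (Finset.mem_range.1 hk)).2.2]
        simp
      _ ≤ ENNReal.ofReal δ' := ENNReal.ofReal_le_ofReal hsum
      _ < δ := hδδ
  have hmeas := H _ hvol
  rw [measure_biUnion_finset
    (fun i hi j hj hij ↦ disjoint_Ioc_of_disjoint_Ioo
      (hdisj i (Finset.mem_range.1 hi) j (Finset.mem_range.1 hj) hij))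
    fun _ _ ↦ measurableSet_Ioc] at hmeas
  rw [← ENNReal.ofReal_le_ofReal_iff hε.le, ENNReal.ofReal_sum_of_nonneg fun _ _ ↦ dist_nonneg]
  refine le_trans (Finset.sum_le_sum fun k hk ↦ ?_) hmeas.le
  have hk' := (hab k (Finset.mem_range.1 hk)).2.2
  rw [StieltjesFunction.measure_Ioc, hg.ofReal_variationStieltjes_sub hc hk', ← edist_dist]
  exact eVariationOn.edist_le _ (left_mem_Icc.2 hk') (right_mem_Icc.2 hk')

lemma metricAC_Icc_of_luzin {X : Type*} [MetricSpace X] [MeasurableSpace X] [BorelSpace X]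
    {γ : ℝ → X} {a b : ℝ} (hab : a ≤ b) (hc : ContinuousOn γ (Icc a b))
    (hbv : BoundedVariationOn γ (Icc a b)) (hN : LuzinN γ (Icc a b)) :
    MetricAC γ (Icc a b) := by
  set g : ℝ → X := fun x ↦ γ (projIcc a b hab x) with hgdef
  have hgc : Continuous g := by
    have := (continuousOn_iff_continuous_domRestrict.1 hc).comp (continuous_projIcc (h := hab))
    exact this
  have hgbv : BoundedVariationOn g univ := by
    refine ne_top_of_le_ne_top hbv (eVariationOn.comp_le_of_monotoneOn γ
      (fun x ↦ (projIcc a b hab x : ℝ)) ?_ fun x _ ↦ (projIcc a b hab x).2)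
    exact fun x _ y _ hxy ↦ monotone_projIcc hab hxy
  have hgN : ∀ N : Set ℝ, volume N = 0 → μH[1] (g '' N) = 0 := by
    intro N h0
    have hsub : g '' N ⊆ γ '' (N ∩ Icc a b ∪ {a, b}) := by
      rintro _ ⟨x, hx, rfl⟩
      rcases le_total x a with hxa | hxa
      · exact ⟨a, by simp, by simp [hgdef, projIcc_of_le_left hab hxa]⟩
      rcases le_total b x with hxb | hxb
      · exact ⟨b, by simp, by simp [hgdef, projIcc_of_right_le hab hxb]⟩
      · exact ⟨x, Or.inl ⟨hx, hxa, hxb⟩, by simp [hgdef, projIcc_of_mem hab ⟨hxa, hxb⟩]⟩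
    refine measure_mono_null hsub (hN _ ?_ ?_)
    · refine union_subset inter_subset_right ?_
      rintro x (rfl | rfl)
      exacts [left_mem_Icc.2 hab, right_mem_Icc.2 hab]
    · exact measure_union_null (measure_mono_null inter_subset_left h0)
        ((Set.toFinite _).measure_zero _)
  have hAC := hgbv.metricAC hgc
    (hgbv.measure_variationStieltjes_absolutelyContinuous hgc hgN) (Icc a b)
  have hγg : ∀ x ∈ Icc a b, g x = γ x := fun x hx ↦ by simp [hgdef, projIcc_of_mem hab hx]
  intro ε hε
  obtain ⟨δ, hδ, H⟩ := hAC ε hε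
  refine ⟨δ, hδ, fun n s t hst hd hsum ↦ ?_⟩
  refine le_of_eq_of_le (Finset.sum_congr rfl fun k hk ↦ ?_) (H n s t hst hd hsum)
  have := hst k (Finset.mem_range.1 hk)
  rw [hγg _ this.1, hγg _ this.2.1]

namespace MetricAC

variable {X : Type*} [MetricSpace X] {γ : ℝ → X}

lemma continuousOn {S : Set ℝ} (h : MetricAC γ S) : ContinuousOn γ S := by
  refine Metric.continuousOn_iff.2 fun x hx ε hε ↦ ?_
  obtain ⟨δ, hδ, H⟩ := h (ε / 2) (half_pos hε)
  refine ⟨δ, hδ, fun y hy hyx ↦ lt_of_le_of_lt ?_ (half_lt_self hε)⟩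
  rw [Real.dist_eq] at hyx
  have key := H 1 (fun _ ↦ min y x) (fun _ ↦ max y x)
    (fun k _ ↦ ⟨by rcases min_choice y x with e | e <;> rwa [e],
      by rcases max_choice y x with e | e <;> rwa [e], min_le_max⟩)
    (fun j hj k hk hjk ↦ absurd (by omega) hjk)
    (by simpa [max_sub_min_eq_abs, abs_sub_comm] using hyx.le)
  rcases le_total y x with hyx | hyx
  · simpa [hyx] using key
  · simpa [hyx, dist_comm] using key

lemma exists_eVariationOn_Icc_le_one {S : Set ℝ} (h : MetricAC γ S) :
    ∃ δ : ℝ, 0 < δ ∧ ∀ c d, Icc c d ⊆ S → d - c ≤ δ → eVariationOn γ (Icc c d) ≤ 1 := by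
  obtain ⟨δ, hδ, H⟩ := h 1 one_pos
  refine ⟨δ, hδ, fun c d hS hdc ↦ iSup_le fun ⟨n, u, hu, hmem⟩ ↦ ?_⟩
  have key := H n u (fun k ↦ u (k + 1))
    (fun k _ ↦ ⟨hS (hmem k), hS (hmem (k + 1)), hu k.le_succ⟩)
    (fun j _ k _ hjk ↦ hu.pairwise_disjoint_on_Ioo_succ hjk) ?_
  · rw [← ENNReal.ofReal_one]
    refine le_trans (le_of_eq ?_) (ENNReal.ofReal_le_ofReal key)
    rw [ENNReal.ofReal_sum_of_nonneg fun _ _ ↦ dist_nonneg]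
    exact Finset.sum_congr rfl fun k _ ↦ by rw [edist_comm, edist_dist]
  · rw [Finset.sum_range_sub]
    linarith [(hmem n).2, (hmem 0).1]

lemma boundedVariationOn {a b : ℝ} (h : MetricAC γ (Icc a b)) :
    BoundedVariationOn γ (Icc a b) := by
  obtain ⟨δ, hδ, H⟩ := h.exists_eVariationOn_Icc_le_one
  have main : ∀ (k : ℕ), ∀ c ∈ Icc a b, c ≤ a + k * δ → eVariationOn γ (Icc a c) ≤ k := by
    intro k
    induction k with
    | zero =>
      intro c hc hck
      obtain rfl : c = a := le_antisymm (by simpa using hck) hc.1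
      simp
    | succ k ih =>
      intro c hc hck
      push_cast at hck ⊢
      have hac : a ≤ max a (c - δ) := le_max_left _ _
      have hcc : max a (c - δ) ≤ c := max_le hc.1 (by linarith)
      have hadd := eVariationOn.Icc_add_Icc γ (s := univ) hac hcc (mem_univ _)
      simp only [univ_inter] at hadd
      rw [← hadd]
      refine add_le_add (ih _ ⟨hac, hcc.trans hc.2⟩ (max_le ?_ ?_))
        (H _ _ (Icc_subset_Icc hac hc.2) ?_)
      · have := mul_nonneg k.cast_nonneg hδ.le
        linarith
      · linarith
      · linarith [le_max_right a (c - δ)]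
  rcases lt_or_ge b a with hab | hab
  · simp [Icc_eq_empty_of_lt hab, BoundedVariationOn]
  obtain ⟨k, hk⟩ := exists_nat_ge ((b - a) / δ)
  rw [div_le_iff₀ hδ] at hk
  exact ne_top_of_le_ne_top (ENNReal.natCast_ne_top k)
    (main k b (right_mem_Icc.2 hab) (by linarith))

/-- Absolute continuity controls sums over intervals indexed by an arbitrary finite set. -/
lemma exists_forall_finset {S : Set ℝ} (h : MetricAC γ S) {ε : ℝ} (hε : 0 < ε) :
    ∃ δ : ℝ, 0 < δ ∧ ∀ {ι : Type} (s : Finset ι) (a b : ι → ℝ),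
      (∀ i ∈ s, a i ∈ S ∧ b i ∈ S ∧ a i ≤ b i) →
      (s : Set ι).PairwiseDisjoint (fun i ↦ Ioo (a i) (b i)) →
      ∑ i ∈ s, (b i - a i) ≤ δ → ∑ i ∈ s, dist (γ (a i)) (γ (b i)) ≤ ε := by
  obtain ⟨δ, hδ, H⟩ := h ε hε
  refine ⟨δ, hδ, fun {ι} s a b hab hdisj hsum ↦ ?_⟩
  rcases s.eq_empty_or_nonempty with rfl | ⟨i₀, -⟩
  · simpa using hε.le
  let e : ℕ → ι := fun k ↦ if hk : k < s.card then s.equivFin.symm ⟨k, hk⟩ else i₀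
  have he : ∀ k (hk : k < s.card), e k = s.equivFin.symm ⟨k, hk⟩ := fun k hk ↦ dif_pos hk
  have hes : ∀ k < s.card, e k ∈ s := fun k hk ↦ by rw [he k hk]; exact Subtype.prop _
  have hinj : ∀ j < s.card, ∀ k < s.card, j ≠ k → e j ≠ e k := by
    intro j hj k hk hjk hEq
    rw [he j hj, he k hk, Subtype.coe_inj, s.equivFin.symm.injective.eq_iff] at hEq
    exact hjk (congrArg Fin.val hEq)
  have hsumeq : ∀ f : ι → ℝ, ∑ k ∈ Finset.range s.card, f (e k) = ∑ i ∈ s, f i := by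
    intro f
    rw [Finset.sum_range, ← Finset.sum_coe_sort s f,
      ← Equiv.sum_comp s.equivFin.symm fun i : s ↦ f i]
    exact Finset.sum_congr rfl fun k _ ↦ by rw [he k k.2]
  rw [← hsumeq fun i ↦ b i - a i] at hsum
  rw [← hsumeq fun i ↦ dist (γ (a i)) (γ (b i))]
  exact H s.card (a ∘ e) (b ∘ e) (fun k hk ↦ hab _ (hes k hk))
    (fun j hj k hk hjk ↦ hdisj (hes j hj) (hes k hk) (hinj j hj k hk hjk)) hsum

end MetricAC

lemma exists_ediam_image_le_two_mul_edist {X : Type*} [MetricSpace X] {γ : ℝ → X} {S : Set ℝ}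
    (hS : S.Nonempty) (hb : Metric.ediam (γ '' S) ≠ ⊤) :
    ∃ x ∈ S, ∃ y ∈ S, x ≤ y ∧ Metric.ediam (γ '' S) ≤ 2 * edist (γ x) (γ y) := by
  suffices ∃ x ∈ S, ∃ y ∈ S, Metric.ediam (γ '' S) ≤ 2 * edist (γ x) (γ y) by
    obtain ⟨x, hx, y, hy, h⟩ := this
    rcases le_total x y with hxy | hxy
    · exact ⟨x, hx, y, hy, hxy, h⟩
    · exact ⟨y, hy, x, hx, hxy, by rwa [edist_comm]⟩
  by_contra! H
  obtain ⟨x, hx⟩ := hS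
  have hpos : Metric.ediam (γ '' S) ≠ 0 := (bot_le.trans_lt (H x hx x hx)).ne'
  refine (ENNReal.half_lt_self hpos hb).not_ge (Metric.ediam_image_le_iff.2 fun s hs t ht ↦ ?_)
  rw [ENNReal.le_div_iff_mul_le (by simp) (by simp), mul_comm]
  exact (H s hs t ht).le

/-- The order-connected components of an open set in `ℝ` that meet `S` form a countable disjoint
cover of the part of the open set in `S`. -/
lemma IsOpen.exists_countable_disjoint_cover {U : Set ℝ} (hU : IsOpen U) (S : Set ℝ) :
    ∃ 𝒞 : Set (Set ℝ), 𝒞.Countable ∧ 𝒞.PairwiseDisjoint id ∧ U ∩ S ⊆ ⋃₀ 𝒞 ∧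
      ∀ C ∈ 𝒞, C ⊆ U ∧ C.OrdConnected ∧ (C ∩ S).Nonempty := by
  have hdisj : (connectedComponentIn U '' (U ∩ S)).PairwiseDisjoint id := by
    rintro _ ⟨x, -, rfl⟩ _ ⟨y, -, rfl⟩ hne
    refine Set.disjoint_left.2 fun z hzx hzy ↦ hne ?_
    rw [connectedComponentIn_eq hzx, connectedComponentIn_eq hzy]
  refine ⟨connectedComponentIn U '' (U ∩ S), ?_, hdisj, fun x hx ↦ ?_, ?_⟩
  · refine hdisj.countable_of_isOpen ?_ ?_
    · rintro _ ⟨x, -, rfl⟩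
      exact hU.connectedComponentIn
    · rintro _ ⟨x, hx, rfl⟩
      exact ⟨x, mem_connectedComponentIn hx.1⟩
  · exact ⟨_, mem_image_of_mem _ hx, mem_connectedComponentIn hx.1⟩
  · rintro _ ⟨x, hx, rfl⟩
    exact ⟨connectedComponentIn_subset _ _, isPreconnected_connectedComponentIn.ordConnected,
      x, mem_connectedComponentIn hx.1, hx.2⟩

lemma MetricAC.exists_cover_tsum_ediam_le {X : Type*} [MetricSpace X] {γ : ℝ → X} {a b : ℝ}
    (h : MetricAC γ (Icc a b)) {N : Set ℝ} (hN : N ⊆ Icc a b)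
    (h0 : volume N = 0) {ε : ℝ} (hε : 0 < ε) :
    ∃ 𝒞 : Set (Set ℝ), 𝒞.Countable ∧ γ '' N ⊆ (⋃ C : 𝒞, γ '' (C ∩ Icc a b)) ∧
      ∑' C : 𝒞, Metric.ediam (γ '' (C ∩ Icc a b)) ≤ 2 * ENNReal.ofReal ε := by
  obtain ⟨δ, hδ, H⟩ := h.exists_forall_finset hε
  obtain ⟨U, hNU, hU, hUδ⟩ := N.exists_isOpen_lt_of_lt (μ := volume) (ENNReal.ofReal δ)
    (by rw [h0]; exact ENNReal.ofReal_pos.2 hδ)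
  obtain ⟨𝒞, hcount, hdisj, hcover, h𝒞⟩ := hU.exists_countable_disjoint_cover (Icc a b)
  have hbdd : ∀ C : 𝒞, Metric.ediam (γ '' (C ∩ Icc a b)) ≠ ⊤ := fun C ↦
    Metric.isBounded_iff_ediam_ne_top.1 <|
      (isCompact_Icc.image_of_continuousOn h.continuousOn).isBounded.subset
        (image_mono inter_subset_right)
  choose x hx y hy hxy hdiam using fun C : 𝒞 ↦
    exists_ediam_image_le_two_mul_edist (h𝒞 C C.2).2.2 (hbdd C)
  have hsub : ∀ C : 𝒞, Ioo (x C) (y C) ⊆ C := fun C ↦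
    Ioo_subset_Icc_self.trans ((h𝒞 C C.2).2.1.out (hx C).1 (hy C).1)
  have hpw : ∀ s : Set 𝒞, s.PairwiseDisjoint fun C ↦ Ioo (x C) (y C) := fun s C _ D _ hCD ↦
    (hdisj C.2 D.2 (Subtype.coe_ne_coe.2 hCD)).mono (hsub C) (hsub D)
  refine ⟨𝒞, hcount, ?_, ?_⟩
  · rintro _ ⟨t, ht, rfl⟩
    obtain ⟨C, hC, htC⟩ := hcover ⟨hNU ht, hN ht⟩
    exact mem_iUnion.2 ⟨⟨C, hC⟩, mem_image_of_mem _ ⟨htC, hN ht⟩⟩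
  · refine (ENNReal.tsum_le_tsum hdiam).trans ?_
    rw [ENNReal.tsum_mul_left]
    gcongr
    refine ENNReal.summable.tsum_le_of_sum_le fun s ↦ ?_
    simp_rw [edist_dist]
    rw [← ENNReal.ofReal_sum_of_nonneg fun _ _ ↦ dist_nonneg]
    refine ENNReal.ofReal_le_ofReal
      (H s x y (fun C _ ↦ ⟨(hx C).2, (hy C).2, hxy C⟩) (hpw _) ?_)
    rw [← ENNReal.ofReal_le_ofReal_iff hδ.le,
      ENNReal.ofReal_sum_of_nonneg fun C _ ↦ sub_nonneg.2 (hxy C)]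
    simp_rw [← Real.volume_Ioo]
    rw [← measure_biUnion_finset (hpw _) fun _ _ ↦ measurableSet_Ioo]
    exact (measure_mono (iUnion₂_subset fun C _ ↦ (hsub C).trans (h𝒞 C C.2).1)).trans hUδ.le

lemma MetricAC.luzinN {X : Type*} [MetricSpace X] [MeasurableSpace X] [BorelSpace X]
    {γ : ℝ → X} {a b : ℝ} (h : MetricAC γ (Icc a b)) : LuzinN γ (Icc a b) := by
  intro N hN h0
  choose 𝒞 hcount hcover hsum using fun n : ℕ ↦
    h.exists_cover_tsum_ediam_le hN h0 (Nat.one_div_pos_of_nat (α := ℝ) (n := n))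
  have hlim : Tendsto (fun n : ℕ ↦ 2 * ENNReal.ofReal (1 / ((n : ℝ) + 1))) atTop (𝓝 0) := by
    have := ENNReal.Tendsto.const_mul (a := 2)
      (ENNReal.tendsto_ofReal (tendsto_one_div_add_atTop_nhds_zero_nat (𝕜 := ℝ)))
      (Or.inr ENNReal.ofNat_ne_top)
    simpa using this
  have : ∀ n, Countable (𝒞 n) := fun n ↦ (hcount n).to_subtype
  refine le_antisymm ?_ bot_le
  calc μH[1] (γ '' N)
      ≤ liminf (fun n ↦ ∑' C : 𝒞 n, Metric.ediam (γ '' (C ∩ Icc a b)) ^ (1 : ℝ)) atTop :=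
        Measure.hausdorffMeasure_le_liminf_tsum 1 _ _ hlim
          (fun n (C : 𝒞 n) ↦ γ '' (C ∩ Icc a b))
          (.of_forall fun n C ↦ (ENNReal.le_tsum C).trans (hsum n)) (.of_forall hcover)
    _ ≤ liminf (fun n : ℕ ↦ 2 * ENNReal.ofReal (1 / ((n : ℝ) + 1))) atTop :=
        liminf_le_liminf (.of_forall fun n ↦ by simpa using hsum n)
    _ = 0 := hlim.liminf_eq

lemma exists_Icc_mem_nhdsWithin {I : Set ℝ} {x : ℝ} (hx : x ∈ I) :
    ∃ a ∈ I, ∃ b ∈ I, a ≤ x ∧ x ≤ b ∧ Icc a b ∈ 𝓝[I] x := by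
  have hleft : ∃ a ∈ I, a ≤ x ∧ Ici a ∈ 𝓝[I] x := by
    by_cases h : ∃ y ∈ I, y < x
    · obtain ⟨y, hy, hyx⟩ := h
      exact ⟨y, hy, hyx.le, mem_nhdsWithin_of_mem_nhds (Ici_mem_nhds hyx)⟩
    · push Not at h
      exact ⟨x, hx, le_rfl, mem_of_superset self_mem_nhdsWithin h⟩
  have hright : ∃ b ∈ I, x ≤ b ∧ Iic b ∈ 𝓝[I] x := by
    by_cases h : ∃ y ∈ I, x < y
    · obtain ⟨y, hy, hxy⟩ := h
      exact ⟨y, hy, hxy.le, mem_nhdsWithin_of_mem_nhds (Iic_mem_nhds hxy)⟩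
    · push Not at h
      exact ⟨x, hx, le_rfl, mem_of_superset self_mem_nhdsWithin h⟩
  obtain ⟨a, ha, hax, hA⟩ := hleft
  obtain ⟨b, hb, hxb, hB⟩ := hright
  exact ⟨a, ha, b, hb, hax, hxb, inter_mem hA hB⟩

/-- Banach–Zaretsky theorem: `γ ∈ AC_loc(I;X)` iff `γ` is continuous,
locally of bounded variation, and has Luzin's property (N). -/
theorem banach_zaretsky {X : Type*} [MetricSpace X] [MeasurableSpace X] [BorelSpace X]
    (I : Set ℝ) (hI : I.OrdConnected) (γ : ℝ → X) :
    MetricACloc γ I ↔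
      (ContinuousOn γ I ∧
       (∀ a ∈ I, ∀ b ∈ I, a ≤ b → eVariationOn γ (Set.Icc a b) < ⊤) ∧
       LuzinN γ I) := by
  constructor
  · intro h
    refine ⟨fun x hx ↦ ?_, fun a ha b hb hab ↦ ?_, fun N hN h0 ↦ ?_⟩
    · obtain ⟨a, ha, b, hb, hax, hxb, hmem⟩ := exists_Icc_mem_nhdsWithin hx
      have hab := hax.trans hxb
      exact ((h a ha b hb hab).continuousOn x ⟨hax, hxb⟩).mono_of_mem_nhdsWithin hmem
    · exact (h a ha b hb hab).boundedVariationOn.lt_top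
    · change OuterMeasure.comap γ (μH[1] : Measure X).toOuterMeasure N = 0
      refine measure_null_of_locally_null N fun x hx ↦ ?_
      obtain ⟨a, ha, b, hb, hax, hxb, hmem⟩ := exists_Icc_mem_nhdsWithin (hN hx)
      have hab := hax.trans hxb
      refine ⟨N ∩ Icc a b, inter_mem self_mem_nhdsWithin (nhdsWithin_mono x hN hmem), ?_⟩
      exact (h a ha b hb hab).luzinN _ inter_subset_right
        (measure_mono_null inter_subset_left h0)
  · rintro ⟨hc, hbv, hN⟩ a ha b hb hab
    have hsub : Icc a b ⊆ I := hI.out ha hb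
    exact metricAC_Icc_of_luzin hab (hc.mono hsub) (hbv a ha b hb hab).ne
      fun N hNab ↦ hN N (hNab.trans hsub)
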